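/- Strict-inequality version of the junction lemma: let K ≥ 1 be an integer, let H_1,…,H_K : ℝ → ℝ be continuous, and let p_1,…,p_K, q_1,…,q_K ∈ ℝ and a, b ∈ ℝ satisfy: a > b; for every i ∈ {1,…,K}, p_i > q_i and a + H_i(p_i) < 0 < b + H_i(q_i); for every choice of p'_1,…,p'_K with p'_i ≤ p_i for all i, min(Σ_{i=1}^K p'_i, min_{1≤i≤K}(a + H_i(p'_i))) ≤ 0; and for every choice of q'_1,…,q'_K with q'_i ≥ q_i for all i, max(Σ_{i=1}^K q'_i, max_{1≤i≤K}(b + H_i(q'_i))) ≥ 0. Then these hypotheses are contradictory (False). -/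

import Mathlib

/-- **Strict-inequality version of the junction lemma.**
Let `K ≥ 1`, let `H_1, …, H_K : ℝ → ℝ` be continuous, and let
`p_i, q_i, a, b` be reals such that `a > b`; for every `i`,
`p_i > q_i` and `a + H_i(p_i) < 0 < b + H_i(q_i)`; for all `p'_i ≤ p_i`,
`min(Σ_i p'_i, min_i (a + H_i(p'_i))) ≤ 0`; and for all `q'_i ≥ q_i`,
`max(Σ_i q'_i, max_i (b + H_i(q'_i))) ≥ 0`.
Then these hypotheses are contradictory. -/
theorem junction_lemma_strict (K : ℕ) (hK : 0 < K) (H : Fin K → ℝ → ℝ)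
    (hH : ∀ i, Continuous (H i))
    (p q : Fin K → ℝ) (a b : ℝ)
    (hab : b < a)
    (hpq : ∀ i, q i < p i)
    (hsub : ∀ i, a + H i (p i) < 0)
    (hsuper : ∀ i, 0 < b + H i (q i))
    (hii : ∀ p' : Fin K → ℝ, (∀ i, p' i ≤ p i) →
      min (∑ i, p' i)
        (Finset.univ.inf' ⟨⟨0, hK⟩, Finset.mem_univ _⟩ fun i => a + H i (p' i)) ≤ 0)
    (hiii : ∀ q' : Fin K → ℝ, (∀ i, q i ≤ q' i) →
      0 ≤ max (∑ i, q' i)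
        (Finset.univ.sup' ⟨⟨0, hK⟩, Finset.mem_univ _⟩ fun i => b + H i (q' i))) :
    False := by
  have crossing : ∀ i, ∀ c ∈ Set.Ioo b a, ∃ x ∈ Set.Icc (q i) (p i), H i x = -c :=
    fun i c hc => intermediate_value_Icc' (hpq i).le (hH i).continuousOn
      ⟨by linarith [hsub i, hc.2], by linarith [hsuper i, hc.1]⟩
  have sum_eq_zero : ∀ x : Fin K → ℝ,
      (∀ i, x i ∈ Set.Icc (q i) (p i) ∧ H i (x i) ∈ Set.Ioo (-a) (-b)) → ∑ i, x i = 0 := by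
    intro x hx
    refine le_antisymm ?_ ?_
    · refine (min_le_iff.mp (hii x fun i => (hx i).1.2)).resolve_right ?_
      refine not_le.mpr ((Finset.lt_inf'_iff _).mpr fun i _ => ?_)
      linarith [(hx i).2.1]
    · refine (le_max_iff.mp (hiii x fun i => (hx i).1.1)).resolve_right ?_
      refine not_le.mpr ((Finset.sup'_lt_iff _).mpr fun i _ => ?_)
      linarith [(hx i).2.2]
  obtain ⟨c, hbc, hca⟩ := exists_between hab
  obtain ⟨d, hcd, hda⟩ := exists_between hca
  choose x hx hHx using fun i => crossing i c ⟨hbc, hca⟩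
  let j : Fin K := ⟨0, hK⟩
  obtain ⟨y, hy, hHy⟩ := crossing j d ⟨hbc.trans hcd, hda⟩
  have hsum := sum_eq_zero x fun i => ⟨hx i, by
    rw [hHx i]; exact ⟨neg_lt_neg hca, neg_lt_neg hbc⟩⟩
  have hsum' := sum_eq_zero (Function.update x j y) fun i => by
    rcases eq_or_ne i j with rfl | hij
    · rw [Function.update_self, hHy]
      exact ⟨hy, neg_lt_neg hda, neg_lt_neg (hbc.trans hcd)⟩
    · rw [Function.update_of_ne hij, hHx i]
      exact ⟨hx i, neg_lt_neg hca, neg_lt_neg hbc⟩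
  rw [Finset.sum_update_of_mem (Finset.mem_univ j)] at hsum'
  rw [← Finset.add_sum_erase _ _ (Finset.mem_univ j), Finset.erase_eq] at hsum
  have hxy : x j = y := by linarith
  linarith [hxy ▸ hHx j]
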